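/- arXiv:1909.04958 — 2 statements merged into one kernel-verified Lean document; each statement's English description precedes it below -/
import Mathlib

section
/- Let A and B be symmetric n×n complex matrices. There exists an invertible upper triangular complex matrix C with CᵀAC = B if and only if for all 1 ≤ k, l ≤ n the upper-left k×l corner submatrices of A and B have equal rank. -/
open Matrix

namespace BorelOrbit

variable {n : ℕ}

/-- Congruence by an invertible upper triangular matrix. -/
def Rel (A B : Matrix (Fin n) (Fin n) ℂ) : Prop :=
  ∃ C : Matrix (Fin n) (Fin n) ℂ, C.det ≠ 0 ∧ C.BlockTriangular id ∧ Cᵀ * A * C = B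

theorem Rel.refl (A : Matrix (Fin n) (Fin n) ℂ) : Rel A A :=
  ⟨1, by simp, Matrix.blockTriangular_one, by simp⟩

theorem Rel.trans {A B D : Matrix (Fin n) (Fin n) ℂ} (h : Rel A B) (h' : Rel B D) : Rel A D := by
  obtain ⟨C, h1, h2, rfl⟩ := h
  obtain ⟨E, h3, h4, rfl⟩ := h'
  refine ⟨C * E, by simp [h1, h3], h2.mul h4, ?_⟩
  simp only [Matrix.transpose_mul, Matrix.mul_assoc]

theorem Rel.symm {A B : Matrix (Fin n) (Fin n) ℂ} (h : Rel A B) : Rel B A := by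
  obtain ⟨C, h1, h2, rfl⟩ := h
  have hu : IsUnit C.det := isUnit_iff_ne_zero.mpr h1
  have : Invertible C := Matrix.invertibleOfIsUnitDet C hu
  refine ⟨C⁻¹, ?_, Matrix.blockTriangular_inv_of_blockTriangular h2, ?_⟩
  · exact (Matrix.isUnit_nonsing_inv_det C hu).ne_zero
  · have e1 : (C⁻¹)ᵀ * Cᵀ = 1 := by
      rw [← Matrix.transpose_mul, Matrix.mul_nonsing_inv C hu, Matrix.transpose_one]
    calc (C⁻¹)ᵀ * (Cᵀ * A * C) * C⁻¹ = ((C⁻¹)ᵀ * Cᵀ) * A * (C * C⁻¹) := by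
          simp only [Matrix.mul_assoc]
      _ = A := by rw [e1, Matrix.mul_nonsing_inv C hu]; simp

theorem Rel.isSymm {A B : Matrix (Fin n) (Fin n) ℂ} (h : Rel A B) (hA : A.IsSymm) : B.IsSymm := by
  obtain ⟨C, h1, h2, rfl⟩ := h
  unfold Matrix.IsSymm at *
  simp [Matrix.transpose_mul, hA, Matrix.mul_assoc]

theorem sum_corner {k : ℕ} (hk : k ≤ n) (f : Fin n → ℂ) (hf : ∀ i : Fin n, k ≤ i → f i = 0) :
    ∑ i, f i = ∑ i : Fin k, f (Fin.castLE hk i) := by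
  symm
  apply Finset.sum_of_injOn (Fin.castLE hk)
  · intro a _ b _ h
    exact Fin.castLE_injective hk h
  · simp
  · intro i _ hi
    apply hf
    by_contra hlt
    exact hi ⟨⟨i, by omega⟩, by simp, by ext; simp⟩
  · simp

theorem Rel.rank_le {A B : Matrix (Fin n) (Fin n) ℂ} (h : Rel A B) {k l : ℕ} (hk : k ≤ n)
    (hl : l ≤ n) : (B.submatrix (Fin.castLE hk) (Fin.castLE hl)).rank ≤
      (A.submatrix (Fin.castLE hk) (Fin.castLE hl)).rank := by
  obtain ⟨C, h1, h2, rfl⟩ := h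
  have key : (Cᵀ * A * C).submatrix (Fin.castLE hk) (Fin.castLE hl) =
      (C.submatrix (Fin.castLE hk) (Fin.castLE hk))ᵀ *
      A.submatrix (Fin.castLE hk) (Fin.castLE hl) *
      C.submatrix (Fin.castLE hl) (Fin.castLE hl) := by
    ext i j
    simp only [Matrix.submatrix_apply, Matrix.mul_apply, Matrix.transpose_apply]
    rw [sum_corner hl]
    · refine Finset.sum_congr rfl fun x _ => ?_
      congr 1
      rw [sum_corner hk]
      intro y hy
      rw [h2 (i := y) (j := Fin.castLE hk i), zero_mul]
      simp only [id, Fin.lt_def, Fin.val_castLE]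
      omega
    · intro y hy
      rw [h2 (i := y) (j := Fin.castLE hl j), mul_zero]
      simp only [id, Fin.lt_def, Fin.val_castLE]
      omega
  rw [key]
  exact (Matrix.rank_mul_le_left _ _).trans (Matrix.rank_mul_le_right _ _)

/-- The elementary operation: add `w l` times vector `p` to vector `l`. -/
theorem rel_op (A : Matrix (Fin n) (Fin n) ℂ) (p : Fin n) (w : Fin n → ℂ)
    (hw : ∀ l, l < p → w l = 0) (hp : 1 + w p ≠ 0) :
    Rel A (Matrix.of fun i l => A i l + w l * A i p + w i * A p l + w i * w l * A p p) := by
  let C : Matrix (Fin n) (Fin n) ℂ := 1 + Matrix.of fun i l => if i = p then w l else 0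
  have hC : C.BlockTriangular id := by
    intro i j hij
    simp only [id] at hij
    simp only [C, Matrix.add_apply, Matrix.of_apply, Matrix.one_apply_ne hij.ne', zero_add]
    split_ifs with h
    · exact hw j (h ▸ hij)
    · rfl
  refine ⟨C, ?_, hC, ?_⟩
  · rw [Matrix.det_of_isUpperTriangular hC, Finset.prod_ne_zero_iff]
    intro i _
    simp only [C, Matrix.add_apply, Matrix.of_apply, Matrix.one_apply_eq]
    split_ifs with h
    · rw [h]; exact hp
    · simp
  · have hm : ∀ (M : Matrix (Fin n) (Fin n) ℂ) i l, (M * C) i l = M i l + w l * M i p := by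
      intro M i l
      have e : (M * C) i l =
          M i l + (M * (Matrix.of fun i l => if i = p then w l else 0)) i l := by
        simp only [C, Matrix.mul_add, Matrix.mul_one, Matrix.add_apply]
      rw [e]
      simp [Matrix.mul_apply, mul_comm]
    have hm' : ∀ (M : Matrix (Fin n) (Fin n) ℂ) i l, (Cᵀ * M) i l = M i l + w i * M p l := by
      intro M i l
      have := hm Mᵀ l i
      have e : (Cᵀ * M) i l = (Mᵀ * C) l i := by
        rw [← Matrix.transpose_apply (Cᵀ * M), Matrix.transpose_mul, Matrix.transpose_transpose]
      rw [e, this]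
      rfl
    ext i l
    rw [hm, hm', hm']
    simp only [Matrix.of_apply]
    ring

/-- Partial permutation-like normal form on the rows in `T`, split off from the rest. -/
structure Done (A : Matrix (Fin n) (Fin n) ℂ) (T : Finset (Fin n)) : Prop where
  block : ∀ i ∈ T, ∀ l, l ∉ T → A i l = 0
  zo : ∀ i ∈ T, ∀ l, A i l = 0 ∨ A i l = 1
  uniq : ∀ i ∈ T, ∀ l l', A i l ≠ 0 → A i l' ≠ 0 → l = l'

theorem step (A : Matrix (Fin n) (Fin n) ℂ) (hA : A.IsSymm) (T : Finset (Fin n))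
    (hT : Done A T) (hne : T ≠ Finset.univ) :
    ∃ A' T', Rel A A' ∧ T ⊂ T' ∧ Done A' T' := by
  have hne' : (Tᶜ).Nonempty := by
    rwa [Finset.nonempty_iff_ne_empty, Ne, Finset.compl_eq_empty_iff]
  obtain ⟨m, hm, hmin⟩ : ∃ m, m ∉ T ∧ ∀ l, l < m → l ∈ T := by
    refine ⟨Tᶜ.min' hne', ?_, ?_⟩
    · simpa using Tᶜ.min'_mem hne'
    · intro l hl
      by_contra h
      exact absurd (Tᶜ.min'_le l (by simpa using h)) (not_le.mpr hl)
  have sy : ∀ i j, A i j = A j i := fun i j => hA.apply j i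
  have hblock : ∀ i, i ∉ T → ∀ l ∈ T, A i l = 0 := fun i hi l hl => by
    rw [sy]; exact hT.block l hl i hi
  by_cases hz : ∀ l, A m l = 0
  · refine ⟨A, insert m T, Rel.refl A, Finset.ssubset_insert hm, ?_, ?_, ?_⟩
    · intro i hi l hl
      rcases Finset.mem_insert.mp hi with rfl | hi
      · exact hz l
      · exact hT.block i hi l (fun h => hl (Finset.mem_insert_of_mem h))
    · intro i hi l
      rcases Finset.mem_insert.mp hi with rfl | hi
      · exact Or.inl (hz l)
      · exact hT.zo i hi l
    · intro i hi l l' h h'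
      rcases Finset.mem_insert.mp hi with rfl | hi
      · exact absurd (hz l) h
      · exact hT.uniq i hi l l' h h'
  push Not at hz
  obtain ⟨j, hj, hjmin⟩ : ∃ j, A m j ≠ 0 ∧ ∀ l, l < j → A m l = 0 := by
    have hs : (Finset.univ.filter fun l => A m l ≠ 0).Nonempty := by
      obtain ⟨l, hl⟩ := hz
      exact ⟨l, by simpa using hl⟩
    refine ⟨Finset.min' _ hs, ?_, ?_⟩
    · simpa using Finset.min'_mem _ hs
    · intro l hl
      by_contra h
      exact absurd (Finset.min'_le _ l (by simpa using h)) (not_le.mpr hl)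
  have hjT : j ∉ T := fun h => hj (hblock m hm j h)
  have hmj : m ≤ j := by
    by_contra h
    exact hjT (hmin j (not_le.mp h))
  -- generic conclusion: rows of `T` unchanged
  have fin : ∀ A' : Matrix (Fin n) (Fin n) ℂ, (∀ i ∈ T, ∀ l, A' i l = A i l) →
      (∀ l, A' m l = if l = j then 1 else 0) → (∀ l, A' j l = if l = m then 1 else 0) →
      Done A' (insert m (insert j T)) := by
    intro A' h1 h2 h3
    refine ⟨?_, ?_, ?_⟩
    · intro i hi l hl
      simp only [Finset.mem_insert, not_or] at hi hl
      rcases hi with rfl | rfl | hi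
      · simp [h2, hl.2.1]
      · simp [h3, hl.1]
      · rw [h1 i hi]; exact hT.block i hi l hl.2.2
    · intro i hi l
      simp only [Finset.mem_insert] at hi
      rcases hi with rfl | rfl | hi
      · rw [h2]; split_ifs <;> simp
      · rw [h3]; split_ifs <;> simp
      · rw [h1 i hi]; exact hT.zo i hi l
    · intro i hi l l' h h'
      simp only [Finset.mem_insert] at hi
      rcases hi with rfl | rfl | hi
      · simp [h2] at h h'; rw [h, h']
      · simp [h3] at h h'; rw [h, h']
      · rw [h1 i hi] at h h'; exact hT.uniq i hi l l' h h'
  have hss : T ⊂ insert m (insert j T) := by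
    refine Finset.ssubset_iff_subset_ne.mpr ⟨fun x hx => by simp [hx], fun h => hm ?_⟩
    rw [h]; simp
  rcases hmj.eq_or_lt with rfl | hlt
  · -- diagonal case
    obtain ⟨s, hs⟩ := IsAlgClosed.exists_pow_nat_eq (A m m)⁻¹ (n := 2) (by norm_num)
    have hs0 : s ≠ 0 := by
      rintro rfl
      simp at hs
      exact hj hs.symm
    have hs1 : s ^ 2 * A m m = 1 := by rw [hs, inv_mul_cancel₀ hj]
    let w : Fin n → ℂ := fun l => if l = m then s - 1 else - A m l / A m m
    have hwT : ∀ i ∈ T, w i = 0 := by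
      intro i hi
      have : i ≠ m := fun h => hm (h ▸ hi)
      simp [w, this, hblock m hm i hi]
    have hwm : w m = s - 1 := by simp [w]
    have hwl : ∀ l, l ≠ m → w l * A m m = - A m l := by
      intro l hl
      simp only [w, if_neg hl]
      field_simp
    refine ⟨_, _, rel_op A m w (fun l hl => hwT l (hmin l hl)) (by rw [hwm]; simpa using hs0),
      hss, fin _ ?_ ?_ ?_⟩
    · intro i hi l
      simp [hwT i hi, hT.block i hi m hm]
    all_goals
      intro l
      simp only [Matrix.of_apply, hwm]
      split_ifs with h
      · subst h; rw [hwm]; linear_combination hs1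
      · linear_combination s * hwl l h
  · -- off-diagonal case
    have hmm : A m m = 0 := hjmin m hlt
    let w : Fin n → ℂ := fun l => if l = j then (A m j)⁻¹ - 1 else - A m l / A m j
    have hwlt : ∀ i, i < j → w i = 0 := by
      intro i hi
      simp [w, hi.ne, hjmin i hi]
    have hwT : ∀ i ∈ T, w i = 0 := by
      intro i hi
      have : i ≠ j := fun h => hjT (h ▸ hi)
      simp [w, this, hblock m hm i hi]
    have r1 := rel_op A j w hwlt (by simpa [w] using hj)
    set A1 : Matrix (Fin n) (Fin n) ℂ :=
      Matrix.of fun i l => A i l + w l * A i j + w i * A j l + w i * w l * A j j with hA1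
    have sy1 : ∀ i j, A1 i j = A1 j i := fun i j => (r1.isSymm hA).apply j i
    have t1 : ∀ i ∈ T, ∀ l, A1 i l = A i l := by
      intro i hi l
      simp [hA1, hwT i hi, hT.block i hi j hjT]
    have m1 : ∀ l, A1 m l = if l = j then 1 else 0 := by
      intro l
      simp only [hA1, Matrix.of_apply, hwlt m hlt]
      split_ifs with h
      · subst h; simp only [w, if_true]; field_simp; ring
      · simp only [w, if_neg h]; field_simp; ring
    have j1 : ∀ l ∈ T, A1 j l = 0 := by
      intro l hl
      rw [sy1, t1 l hl, hT.block l hl j hjT]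
    have jm1 : A1 j m = 1 := by rw [sy1, m1]; simp
    have mm1 : A1 m m = 0 := by rw [m1]; simp [hlt.ne]
    let u : Fin n → ℂ := fun l => if l = m then 0 else if l = j then - A1 j j / 2 else - A1 j l
    have huT : ∀ i ∈ T, u i = 0 := by
      intro i hi
      have h1 : i ≠ j := fun h => hjT (h ▸ hi)
      have h2 : i ≠ m := fun h => hm (h ▸ hi)
      simp [u, h1, h2, j1 i hi]
    have hum : u m = 0 := by simp [u]
    have huj : u j = - A1 j j / 2 := by simp [u, hlt.ne']
    have r2 := rel_op A1 m u (fun l hl => huT l (hmin l hl)) (by simp [hum])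
    refine ⟨_, _, r1.trans r2, hss, fin _ ?_ ?_ ?_⟩
    · intro i hi l
      simp [huT i hi, t1 i hi, hT.block i hi m hm]
    · intro l
      simp [hum, m1, hlt.ne]
    · intro l
      simp only [Matrix.of_apply, jm1, mm1, huj, m1]
      by_cases h : l = m
      · subst h; simp [hum, jm1, hlt.ne]
      · by_cases h' : l = j
        · subst h'; simp only [huj, if_neg h, if_true]; ring
        · simp [u, h, h']

theorem exists_done (A : Matrix (Fin n) (Fin n) ℂ) (hA : A.IsSymm) :
    ∃ P, Rel A P ∧ Done P Finset.univ := by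
  have main : ∀ (d : ℕ) (A : Matrix (Fin n) (Fin n) ℂ) (T : Finset (Fin n)), A.IsSymm →
      Done A T → (Tᶜ).card ≤ d → ∃ P, Rel A P ∧ Done P Finset.univ := by
    intro d
    induction d with
    | zero =>
      intro A T hA hT hc
      have : T = Finset.univ := by
        rw [← Finset.compl_eq_empty_iff, ← Finset.card_eq_zero]; omega
      exact ⟨A, Rel.refl A, this ▸ hT⟩
    | succ d ih =>
      intro A T hA hT hc
      by_cases h : T = Finset.univ
      · exact ⟨A, Rel.refl A, h ▸ hT⟩
      · obtain ⟨A', T', r, hs, hd⟩ := step A hA T hT h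
        have : (T'ᶜ).card < (Tᶜ).card :=
          Finset.card_lt_card (Finset.compl_ssubset_compl.mpr hs)
        obtain ⟨P, r', hP⟩ := ih A' T' (r.isSymm hA) hd (by omega)
        exact ⟨P, r.trans r', hP⟩
  exact main _ A ∅ hA ⟨by simp, by simp, by simp⟩ le_rfl

/-- Rank of a partial permutation matrix. -/
theorem rank_pp {ι κ : Type} [Fintype ι] [Fintype κ] (M : Matrix ι κ ℂ)
    [DecidablePred fun i => ∃ l, M i l ≠ 0] (zo : ∀ i l, M i l = 0 ∨ M i l = 1)
    (uniq : ∀ i l l', M i l ≠ 0 → M i l' ≠ 0 → l = l')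
    (cuniq : ∀ i i' l, M i l ≠ 0 → M i' l ≠ 0 → i = i') :
    M.rank = (Finset.univ.filter fun i => ∃ l, M i l ≠ 0).card := by
  classical
  let S := {i // ∃ l, M i l ≠ 0}
  choose f hf using fun i : S => i.2
  have finj : Function.Injective f := by
    intro a b h
    exact Subtype.ext (cuniq _ _ (f a) (hf a) (h ▸ hf b))
  have hrow : ∀ i : S, M.row i = Pi.single (f i) 1 := by
    intro i
    ext l
    by_cases h : l = f i
    · subst h
      simpa using (zo i (f i)).resolve_left (hf i)
    · rw [Pi.single_eq_of_ne h]
      by_contra h0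
      exact h (uniq _ _ _ h0 (hf i))
  have li : LinearIndependent ℂ (fun i : S => M.row i) := by
    have := (Pi.basisFun ℂ κ).linearIndependent.comp f finj
    convert this using 1
    ext i : 1
    simp [hrow]
  have hspan : Submodule.span ℂ (Set.range M.row) =
      Submodule.span ℂ (Set.range fun i : S => M.row i) := by
    apply le_antisymm
    · rw [Submodule.span_le]
      rintro _ ⟨i, rfl⟩
      by_cases h : ∃ l, M i l ≠ 0
      · exact Submodule.subset_span ⟨⟨i, h⟩, rfl⟩
      · push Not at h
        have : M.row i = 0 := by ext l; exact h l
        rw [this]; exact Submodule.zero_mem _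
    · apply Submodule.span_mono
      rintro _ ⟨i, rfl⟩
      exact ⟨i, rfl⟩
  rw [Matrix.rank_eq_finrank_span_row, hspan, finrank_span_eq_card li, Fintype.card_subtype]

open Classical in
theorem rank_corner (P : Matrix (Fin n) (Fin n) ℂ) (hs : P.IsSymm) (hP : Done P Finset.univ)
    (k l : ℕ) (hk : k ≤ n) (hl : l ≤ n) :
    (P.submatrix (Fin.castLE hk) (Fin.castLE hl)).rank =
    (Finset.univ.filter fun i : Fin n => (i : ℕ) < k ∧ ∃ j : Fin n, (j : ℕ) < l ∧ P i j ≠ 0).card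
    := by
  rw [rank_pp]
  · apply Finset.card_bij (fun i _ => Fin.castLE hk i)
    · intro i hi
      obtain ⟨j, hj⟩ := (Finset.mem_filter.mp hi).2
      exact Finset.mem_filter.mpr ⟨Finset.mem_univ _, by simp, Fin.castLE hl j, by simp, hj⟩
    · intro a _ b _ h
      exact Fin.castLE_injective hk h
    · intro i hi
      simp only [Finset.mem_filter, Finset.mem_univ, true_and] at hi
      obtain ⟨h1, j, h2, h3⟩ := hi
      refine ⟨⟨i, h1⟩, ?_, rfl⟩
      exact Finset.mem_filter.mpr ⟨Finset.mem_univ _, ⟨j, h2⟩, h3⟩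
  · intro i l
    exact hP.zo _ (Finset.mem_univ _) _
  · intro i l l' h h'
    exact Fin.castLE_injective hl (hP.uniq _ (Finset.mem_univ _) _ _ h h')
  · intro i i' l h h'
    simp only [Matrix.submatrix_apply] at h h'
    rw [← hs.apply] at h h'
    exact Fin.castLE_injective hk (hP.uniq _ (Finset.mem_univ _) _ _ h h')

open Classical in
theorem count_succ (q : Fin n → Prop) (k : Fin n) :
    (Finset.univ.filter fun i : Fin n => (i : ℕ) < k + 1 ∧ q i).card =
    (Finset.univ.filter fun i : Fin n => (i : ℕ) < k ∧ q i).card + if q k then 1 else 0 := by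
  split_ifs with h
  · have : (Finset.univ.filter fun i : Fin n => (i : ℕ) < k + 1 ∧ q i) =
        insert k (Finset.univ.filter fun i : Fin n => (i : ℕ) < k ∧ q i) := by
      ext i
      simp only [Finset.mem_filter, Finset.mem_univ, true_and, Finset.mem_insert, Fin.ext_iff]
      constructor
      · rintro ⟨h1, h2⟩
        by_cases e : (i : ℕ) = k
        · exact Or.inl e
        · exact Or.inr ⟨by omega, h2⟩
      · rintro (h1 | ⟨h1, h2⟩)
        · exact ⟨by omega, (Fin.ext h1 : i = k) ▸ h⟩
        · exact ⟨by omega, h2⟩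
    rw [this, Finset.card_insert_of_notMem (by simp)]
  · rw [add_zero]
    congr 1
    ext i
    simp only [Finset.mem_filter, Finset.mem_univ, true_and]
    constructor
    · rintro ⟨h1, h2⟩
      refine ⟨?_, h2⟩
      by_contra h3
      have : i = k := Fin.ext (by omega)
      exact h (this ▸ h2)
    · rintro ⟨h1, h2⟩
      exact ⟨by omega, h2⟩

theorem done_eq (P Q : Matrix (Fin n) (Fin n) ℂ) (hPs : P.IsSymm) (hQs : Q.IsSymm)
    (hP : Done P Finset.univ) (hQ : Done Q Finset.univ)
    (h : ∀ (k l : ℕ) (hk : k ≤ n) (hl : l ≤ n), 1 ≤ k → 1 ≤ l →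
        (P.submatrix (Fin.castLE hk) (Fin.castLE hl)).rank =
        (Q.submatrix (Fin.castLE hk) (Fin.castLE hl)).rank) : P = Q := by
  classical
  have hc : ∀ (k l : ℕ), k ≤ n → l ≤ n →
      (Finset.univ.filter fun i : Fin n =>
        (i : ℕ) < k ∧ ∃ j : Fin n, (j : ℕ) < l ∧ P i j ≠ 0).card =
      (Finset.univ.filter fun i : Fin n =>
        (i : ℕ) < k ∧ ∃ j : Fin n, (j : ℕ) < l ∧ Q i j ≠ 0).card := by
    intro k l hk hl
    rcases Nat.eq_zero_or_pos k with rfl | hk0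
    · simp
    rcases Nat.eq_zero_or_pos l with rfl | hl0
    · simp
    have := h k l hk hl hk0 hl0
    rw [rank_corner P hPs hP, rank_corner Q hQs hQ] at this
    convert this
  have hex : ∀ (k : Fin n) (l : ℕ), l ≤ n →
      ((∃ j : Fin n, (j : ℕ) < l ∧ P k j ≠ 0) ↔ (∃ j : Fin n, (j : ℕ) < l ∧ Q k j ≠ 0)) := by
    intro k l hl
    have h1 := hc (k + 1) l k.2 hl
    have h2 := hc k l k.2.le hl
    have e1 := count_succ (fun i => ∃ j : Fin n, (j : ℕ) < l ∧ P i j ≠ 0) k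
    have e2 := count_succ (fun i => ∃ j : Fin n, (j : ℕ) < l ∧ Q i j ≠ 0) k
    have e3 : (if (∃ j : Fin n, (j : ℕ) < l ∧ P k j ≠ 0) then 1 else 0) =
        (if (∃ j : Fin n, (j : ℕ) < l ∧ Q k j ≠ 0) then 1 else 0) := by
      have : ∀ a b c d e f : ℕ, a = b → c = d → a = c + e → b = d + f → e = f := by omega
      exact this _ _ _ _ _ _ h1 h2 (by convert e1) (by convert e2)
    split_ifs at e3 with c1 c2 c2
    · exact ⟨fun _ => c2, fun _ => c1⟩
    · exact ⟨fun h => absurd h c1, fun h => absurd h c2⟩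
  have char : ∀ (M : Matrix (Fin n) (Fin n) ℂ), Done M Finset.univ → ∀ k j : Fin n,
      M k j ≠ 0 ↔ (∃ j' : Fin n, (j' : ℕ) < j + 1 ∧ M k j' ≠ 0) ∧
        ¬ (∃ j' : Fin n, (j' : ℕ) < j ∧ M k j' ≠ 0) := by
    intro M hM k j
    constructor
    · intro h0
      refine ⟨⟨j, by omega, h0⟩, ?_⟩
      rintro ⟨j', h1, h2⟩
      have := hM.uniq k (Finset.mem_univ _) _ _ h0 h2
      subst this
      omega
    · rintro ⟨⟨j', h1, h2⟩, h3⟩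
      have : j' = j := by
        by_contra hne
        exact h3 ⟨j', by have := Fin.val_ne_of_ne hne; omega, h2⟩
      exact this ▸ h2
  ext k j
  have hiff : P k j ≠ 0 ↔ Q k j ≠ 0 := by
    rw [char P hP, char Q hQ, hex k (j + 1) j.2, hex k j j.2.le]
  rcases hP.zo k (Finset.mem_univ _) j with h1 | h1 <;>
    rcases hQ.zo k (Finset.mem_univ _) j with h2 | h2 <;>
    rw [h1, h2] at hiff ⊢ <;> simp at hiff

end BorelOrbit

/-- Section 6.1 (classification of Borel orbits on quadratic forms): two symmetric complex
`n×n` matrices `A`, `B` are congruent via an invertible upper triangular matrix iff for all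
`1 ≤ k, l ≤ n` the upper-left `k×l` corner submatrices of `A` and `B` have equal rank. -/
theorem borel_orbit_iff_corner_ranks (n : ℕ) (A B : Matrix (Fin n) (Fin n) ℂ)
    (hA : A.IsSymm) (hB : B.IsSymm) :
    (∃ C : Matrix (Fin n) (Fin n) ℂ, C.det ≠ 0 ∧ C.BlockTriangular id ∧ Cᵀ * A * C = B) ↔
      ∀ (k l : ℕ) (hk : k ≤ n) (hl : l ≤ n), 1 ≤ k → 1 ≤ l →
        (A.submatrix (Fin.castLE hk) (Fin.castLE hl)).rank =
        (B.submatrix (Fin.castLE hk) (Fin.castLE hl)).rank := by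
  constructor
  · intro h k l hk hl _ _
    have h' : BorelOrbit.Rel A B := h
    exact le_antisymm (h'.symm.rank_le hk hl) (h'.rank_le hk hl)
  · intro h
    obtain ⟨P, rP, hP⟩ := BorelOrbit.exists_done A hA
    obtain ⟨Q, rQ, hQ⟩ := BorelOrbit.exists_done B hB
    have : P = Q := by
      refine BorelOrbit.done_eq P Q (rP.isSymm hA) (rQ.isSymm hB) hP hQ ?_
      intro k l hk hl hk1 hl1
      have e1 := le_antisymm (rP.rank_le hk hl) (rP.symm.rank_le hk hl)
      have e2 := le_antisymm (rQ.rank_le hk hl) (rQ.symm.rank_le hk hl)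
      rw [e1, e2, h k l hk hl hk1 hl1]
    subst this
    exact rP.trans rQ.symm
end

section
/- Every symmetric n×n complex matrix A is congruent, via an invertible upper triangular complex matrix C (i.e. CᵀAC = P), to a unique symmetric matrix P all of whose entries are 0 or 1 and such that every row of P contains at most one nonzero entry. -/
open Matrix

namespace PatternAux

lemma diag_ne {n : ℕ} {D : Matrix (Fin n) (Fin n) ℂ} (hD : D.BlockTriangular id)
    (h : D.det ≠ 0) (i : Fin n) : D i i ≠ 0 := by
  rw [Matrix.det_of_upperTriangular hD] at h
  exact (Finset.prod_ne_zero_iff.mp h) i (Finset.mem_univ i)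

lemma unique_aux {n : ℕ} {P Q D M : Matrix (Fin n) (Fin n) ℂ}
    (hP : P.IsSymm) (hP1 : ∀ i j, P i j = 0 ∨ P i j = 1)
    (hP2 : ∀ i j k, P i j ≠ 0 → P i k ≠ 0 → j = k)
    (hQ1 : ∀ i j, Q i j = 0 ∨ Q i j = 1)
    (hQ2 : ∀ i j k, Q i j ≠ 0 → Q i k ≠ 0 → j = k)
    (hQ : Q.IsSymm)
    (hD : D.BlockTriangular id) (hM : M.BlockTriangular id)
    (hDd : ∀ i, D i i ≠ 0) (hMd : ∀ i, M i i ≠ 0)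
    (h : P * D = Mᵀ * Q) : P = Q := by
  have key : ∀ m : ℕ, ∀ i j : Fin n, i.val + j.val = m → P i j = Q i j := by
    intro m
    induction m using Nat.strong_induction_on with
    | _ m ih =>
      intro i j hij
      have hrow : ∀ k, k < j → P i k = Q i k := fun k hk =>
        ih (i.val + k.val) (by have : k.val < j.val := hk; omega) i k rfl
      have hcol : ∀ k, k < i → P k j = Q k j := fun k hk =>
        ih (k.val + j.val) (by have : k.val < i.val := hk; omega) k j rfl
      have e := congrFun (congrFun h i) j
      rw [Matrix.mul_apply, Matrix.mul_apply] at e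
      have eP : ∀ (hz : ∀ k, k < j → P i k = 0), ∑ k, P i k * D k j = P i j * D j j := by
        intro hz
        refine Finset.sum_eq_single j ?_ (by simp)
        intro k _ hk
        rcases lt_or_gt_of_ne hk with hk | hk
        · simp [hz k hk]
        · rw [hD hk, mul_zero]
      have eQ : ∀ (hz : ∀ k, k < i → Q k j = 0), ∑ k, Mᵀ i k * Q k j = M i i * Q i j := by
        intro hz
        refine Finset.sum_eq_single i ?_ (by simp)
        intro k _ hk
        rcases lt_or_gt_of_ne hk with hk | hk
        · simp [hz k hk]
        · rw [Matrix.transpose_apply, hM hk, zero_mul]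
      rcases hP1 i j with p | p <;> rcases hQ1 i j with q | q
      · rw [p, q]
      · exfalso
        have q0 : Q i j ≠ 0 := by rw [q]; exact one_ne_zero
        rw [eP, eQ] at e
        · rw [p, q] at e
          exact hMd i (by simpa using e.symm)
        · intro k hk
          by_contra hne
          refine hk.ne (hQ2 j k i ?_ ?_)
          · rwa [hQ.apply]
          · rwa [hQ.apply]
        · intro k hk
          rw [hrow k hk]
          by_contra hne
          exact hk.ne (hQ2 i k j hne q0)
      · exfalso
        have p0 : P i j ≠ 0 := by rw [p]; exact one_ne_zero
        rw [eP, eQ] at e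
        · rw [p, q] at e
          exact hDd j (by simpa using e)
        · intro k hk
          rw [← hcol k hk]
          by_contra hne
          refine hk.ne (hP2 j k i ?_ ?_)
          · rwa [hP.apply]
          · rwa [hP.apply]
        · intro k hk
          by_contra hne
          exact hk.ne (hP2 i k j hne p0)
      · rw [p, q]
  ext i j
  exact key _ i j rfl

/-- The family `v` is adapted to the standard flag. -/
def Adapted {n : ℕ} (v : Fin n → Fin n → ℂ) : Prop :=
  ∀ k, v k k ≠ 0 ∧ ∀ l, k < l → v k l = 0

lemma exists_aux {n : ℕ} (B : LinearMap.BilinForm ℂ (Fin n → ℂ))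
    (hB : ∀ x y, B x y = B y x) (S : Finset (Fin n)) :
    ∀ v : Fin n → Fin n → ℂ, Adapted v →
      (∀ i, i ∉ S → ∀ j, B (v i) (v j) = 0 ∨ (B (v i) (v j) = 1 ∧ j ∉ S)) →
      (∀ i, i ∉ S → ∀ j k, B (v i) (v j) ≠ 0 → B (v i) (v k) ≠ 0 → j = k) →
      ∃ w : Fin n → Fin n → ℂ, Adapted w ∧
        (∀ i j, B (w i) (w j) = 0 ∨ B (w i) (w j) = 1) ∧
        (∀ i j k, B (w i) (w j) ≠ 0 → B (w i) (w k) ≠ 0 → j = k) := by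
  induction S using Finset.strongInduction with
  | _ S ih =>
  intro v hv h1 h2
  rcases S.eq_empty_or_nonempty with rfl | hne
  · exact ⟨v, hv, fun i j => (h1 i (by simp) j).imp id And.left, fun i => h2 i (by simp)⟩
  obtain ⟨i, hiS, himin⟩ : ∃ i ∈ S, ∀ k ∈ S, i ≤ k :=
    ⟨S.min' hne, S.min'_mem hne, fun k hk => S.min'_le k hk⟩
  -- entries between `S` and its complement vanish
  have h0 : ∀ a, a ∉ S → ∀ b ∈ S, B (v a) (v b) = 0 := fun a ha b hb => by
    rcases h1 a ha b with h | h
    · exact h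
    · exact absurd hb h.2
  have h0' : ∀ a ∈ S, ∀ b, b ∉ S → B (v a) (v b) = 0 := fun a ha b hb => by
    rw [hB]; exact h0 b hb a ha
  by_cases hz : ∀ k ∈ S, B (v i) (v k) = 0
  · have hall : ∀ k, B (v i) (v k) = 0 := fun k => by
      by_cases hk : k ∈ S
      · exact hz k hk
      · exact h0' i hiS k hk
    refine ih (S.erase i) (Finset.erase_ssubset hiS) v hv ?_ ?_
    · intro a ha b
      by_cases hai : a = i
      · subst hai; exact Or.inl (hall b)
      · have haS : a ∉ S := fun h => ha (Finset.mem_erase.mpr ⟨hai, h⟩)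
        exact (h1 a haS b).imp id fun h => ⟨h.1, fun h' => h.2 (Finset.mem_of_mem_erase h')⟩
    · intro a ha b c hb hc
      by_cases hai : a = i
      · subst hai; exact absurd (hall b) hb
      · have haS : a ∉ S := fun h => ha (Finset.mem_erase.mpr ⟨hai, h⟩)
        exact h2 a haS b c hb hc
  push Not at hz
  obtain ⟨j, hjS, hj, hjmin⟩ : ∃ j ∈ S, B (v i) (v j) ≠ 0 ∧
      ∀ k ∈ S, k < j → B (v i) (v k) = 0 := by
    have hne' : (S.filter fun k => B (v i) (v k) ≠ 0).Nonempty := by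
      obtain ⟨k, hk, hk'⟩ := hz
      exact ⟨k, Finset.mem_filter.mpr ⟨hk, hk'⟩⟩
    have hm := Finset.min'_mem _ hne'
    refine ⟨_, (Finset.mem_filter.mp hm).1, (Finset.mem_filter.mp hm).2, ?_⟩
    intro k hk hlt
    by_contra hcon
    exact absurd (Finset.min'_le _ k (Finset.mem_filter.mpr ⟨hk, hcon⟩)) (not_le.mpr hlt)
  by_cases hji : j = i
  · subst hji
    obtain ⟨s, hs⟩ : ∃ s : ℂ, s * s = B (v j) (v j) := by
      obtain ⟨s, hs⟩ := IsAlgClosed.exists_pow_nat_eq (B (v j) (v j)) (n := 2) (by norm_num)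
      exact ⟨s, by rw [← hs]; ring⟩
    have hs0 : s ≠ 0 := by rintro rfl; apply hj; rw [← hs]; simp
    let w : Fin n → Fin n → ℂ := fun k =>
      if k = j then s⁻¹ • v j else
      if k ∈ S then v k - (B (v j) (v k) / B (v j) (v j)) • v j else v k
    have wj : w j = s⁻¹ • v j := by simp [w]
    have wS : ∀ k ∈ S, k ≠ j → w k = v k - (B (v j) (v k) / B (v j) (v j)) • v j := by
      intro k hk hkj; simp [w, hk, hkj]
    have wN : ∀ k, k ∉ S → w k = v k := by
      intro k hk
      have hkj : k ≠ j := by rintro rfl; exact hk hjS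
      simp [w, hk, hkj]
    have bjj : B (w j) (w j) = 1 := by
      rw [wj]; simp [← hs]; field_simp
    have bjk : ∀ k, k ≠ j → B (w j) (w k) = 0 := by
      intro k hk
      by_cases hkS : k ∈ S
      · rw [wj, wS k hkS hk]; simp [hj]
      · rw [wj, wN k hkS]; simp [h0' j hjS k hkS]
    have bN : ∀ a, a ∉ S → ∀ k, B (w a) (w k) = if k ∈ S then 0 else B (v a) (v k) := by
      intro a ha k
      rw [wN a ha]
      split_ifs with hk
      · by_cases hkj : k = j
        · subst hkj; rw [wj]; simp [h0 a ha k hk]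
        · rw [wS k hk hkj]; simp [h0 a ha k hk, h0 a ha j hjS]
      · rw [wN k hk]
    refine ih (S.erase j) (Finset.erase_ssubset hjS) w ?_ ?_ ?_
    · intro k
      by_cases hkj : k = j
      · subst hkj; rw [wj]
        refine ⟨by simpa [hs0] using (hv k).1, fun l hl => by simp [(hv k).2 l hl]⟩
      · by_cases hkS : k ∈ S
        · have hjk : j < k := lt_of_le_of_ne (himin k hkS) (Ne.symm hkj)
          rw [wS k hkS hkj]
          refine ⟨by simpa [(hv j).2 k hjk] using (hv k).1, fun l hl => ?_⟩
          simp [(hv k).2 l hl, (hv j).2 l (hjk.trans hl)]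
        · rw [wN k hkS]; exact hv k
    · intro a ha b
      by_cases haj : a = j
      · subst haj
        by_cases hb : b = a
        · subst hb; right; exact ⟨bjj, by simp⟩
        · left; exact bjk b hb
      · have haS : a ∉ S := fun h => ha (Finset.mem_erase.mpr ⟨haj, h⟩)
        rw [bN a haS]
        split_ifs with hb
        · exact Or.inl rfl
        · exact (h1 a haS b).imp id fun h => ⟨h.1, fun h' => h.2 (Finset.mem_of_mem_erase h')⟩
    · intro a ha b c hb hc
      by_cases haj : a = j
      · subst haj
        have e1 : b = a := by by_contra h; exact hb (bjk b h)
        have e2 : c = a := by by_contra h; exact hc (bjk c h)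
        rw [e1, e2]
      · have haS : a ∉ S := fun h => ha (Finset.mem_erase.mpr ⟨haj, h⟩)
        rw [bN a haS] at hb hc
        split_ifs at hb hc with x y <;> first | exact absurd rfl hb | exact absurd rfl hc | skip
        exact h2 a haS b c hb hc
  · have hij : i < j := lt_of_le_of_ne (himin j hjS) (Ne.symm hji)
    have hii : B (v i) (v i) = 0 := hjmin i hiS hij
    have hji' : B (v j) (v i) = B (v i) (v j) := hB _ _
    set a := B (v i) (v j) with ha_def
    -- coefficients
    let c : ℂ := B (v j) (v j) / (2 * a)
    let α : Fin n → ℂ := fun k => B (v i) (v k) / a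
    let β : Fin n → ℂ := fun k => (B (v j) (v k) - α k * B (v j) (v j)) / a
    let w : Fin n → Fin n → ℂ := fun k =>
      if k = i then v i else
      if k = j then a⁻¹ • (v j - c • v i) else
      if k ∈ S then v k - α k • v j - β k • v i else v k
    have wi : w i = v i := by simp [w]
    have wj : w j = a⁻¹ • (v j - c • v i) := by simp [w, hji]
    have wS : ∀ k ∈ S, k ≠ i → k ≠ j → w k = v k - α k • v j - β k • v i := by
      intro k hk hki hkj; simp [w, hk, hki, hkj]
    have wN : ∀ k, k ∉ S → w k = v k := by
      intro k hk
      have hkj : k ≠ j := by rintro rfl; exact hk hjS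
      have hki : k ≠ i := by rintro rfl; exact hk hiS
      simp [w, hk, hkj, hki]
    have bij : B (w i) (w j) = 1 := by
      rw [wi, wj]; simp [hii, ← ha_def, hj]
    have bji : B (w j) (w i) = 1 := by rw [hB, bij]
    have bik : ∀ k, k ≠ j → B (w i) (w k) = 0 := by
      intro k hk
      by_cases hki : k = i
      · subst hki; rw [wi, hii]
      by_cases hkS : k ∈ S
      · rw [wi, wS k hkS hki hk]; simp [hii, ← ha_def, α, hj]
      · rw [wi, wN k hkS]; exact h0' i hiS k hkS
    have bjk : ∀ k, k ≠ i → B (w j) (w k) = 0 := by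
      intro k hk
      by_cases hkj : k = j
      · subst hkj; rw [wj]
        simp only [map_sub, map_smul, LinearMap.sub_apply, LinearMap.smul_apply, smul_eq_mul,
          hii, hji', ← ha_def, c]
        field_simp
        ring
      by_cases hkS : k ∈ S
      · rw [wj, wS k hkS hk hkj]
        simp only [map_sub, map_smul, LinearMap.sub_apply, LinearMap.smul_apply, smul_eq_mul,
          hii, hji', ← ha_def, c, α, β]
        field_simp
        ring
      · rw [wj, wN k hkS]; simp [h0' j hjS k hkS, h0' i hiS k hkS]
    have bN : ∀ p, p ∉ S → ∀ k, B (w p) (w k) = if k ∈ S then 0 else B (v p) (v k) := by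
      intro p hp k
      rw [wN p hp]
      split_ifs with hk
      · by_cases hkj : k = j
        · subst hkj; rw [wj]; simp [h0 p hp k hk, h0 p hp i hiS]
        · by_cases hki : k = i
          · subst hki; rw [wi]; exact h0 p hp k hk
          · rw [wS k hk hki hkj]; simp [h0 p hp k hk, h0 p hp j hjS, h0 p hp i hiS]
      · rw [wN k hk]
    have hsub : (S.erase i).erase j ⊂ S :=
      lt_of_le_of_lt (Finset.erase_subset _ _) (Finset.erase_ssubset hiS)
    have hnot : ∀ b, b ∉ S → b ∉ (S.erase i).erase j := fun b hb h =>
      hb (Finset.mem_of_mem_erase (Finset.mem_of_mem_erase h))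
    have hout : ∀ b, b ∉ (S.erase i).erase j → b ≠ i → b ≠ j → b ∉ S := fun b hb hbi hbj h =>
      hb (Finset.mem_erase.mpr ⟨hbj, Finset.mem_erase.mpr ⟨hbi, h⟩⟩)
    refine ih _ hsub w ?_ ?_ ?_
    · intro k
      by_cases hki : k = i
      · subst hki; rw [wi]; exact hv k
      by_cases hkj : k = j
      · subst hkj; rw [wj]
        refine ⟨by simpa [hj, (hv i).2 k hij] using (hv k).1, fun l hl => ?_⟩
        simp [(hv k).2 l hl, (hv i).2 l (hij.trans hl)]
      by_cases hkS : k ∈ S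
      · have hik : i < k := lt_of_le_of_ne (himin k hkS) (Ne.symm hki)
        rw [wS k hkS hki hkj]
        have hα : ∀ l, k ≤ l → α k * v j l = 0 := by
          intro l hl
          rcases lt_or_gt_of_ne hkj with h | h
          · simp [α, hjmin k hkS h]
          · simp [(hv j).2 l (h.trans_le hl)]
        refine ⟨by simpa [hα k le_rfl, (hv i).2 k hik] using (hv k).1, fun l hl => ?_⟩
        have := hα l hl.le
        simp only [Pi.sub_apply, Pi.smul_apply, smul_eq_mul, this, (hv k).2 l hl,
          (hv i).2 l (hik.trans hl)]
        ring
      · rw [wN k hkS]; exact hv k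
    · intro p hp b
      by_cases hpi : p = i
      · subst hpi
        by_cases hb : b = j
        · subst hb; right; exact ⟨bij, by simp⟩
        · left; exact bik b hb
      by_cases hpj : p = j
      · subst hpj
        by_cases hb : b = i
        · subst hb; right; exact ⟨bji, by simp⟩
        · left; exact bjk b hb
      have hpS := hout p hp hpi hpj
      rw [bN p hpS]
      split_ifs with hb
      · exact Or.inl rfl
      · exact (h1 p hpS b).imp id fun h => ⟨h.1, hnot b h.2⟩
    · intro p hp b d hb hd
      by_cases hpi : p = i
      · subst hpi
        have e1 : b = j := by by_contra h; exact hb (bik b h)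
        have e2 : d = j := by by_contra h; exact hd (bik d h)
        rw [e1, e2]
      by_cases hpj : p = j
      · subst hpj
        have e1 : b = i := by by_contra h; exact hb (bjk b h)
        have e2 : d = i := by by_contra h; exact hd (bjk d h)
        rw [e1, e2]
      have hpS := hout p hp hpi hpj
      rw [bN p hpS] at hb hd
      split_ifs at hb hd with x y <;> first | exact absurd rfl hb | exact absurd rfl hd | skip
      exact h2 p hpS b d hb hd

end PatternAux

/-- Section 6.1 (patterns): every symmetric complex `n×n` matrix is congruent, via an
invertible upper triangular complex matrix, to a unique symmetric `0–1` matrix having at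
most one nonzero entry in each row. -/
theorem congruent_to_unique_pattern (n : ℕ) (A : Matrix (Fin n) (Fin n) ℂ)
    (hA : A.IsSymm) :
    ∃! P : Matrix (Fin n) (Fin n) ℂ,
      (P.IsSymm ∧ (∀ i j, P i j = 0 ∨ P i j = 1) ∧
        (∀ i j k, P i j ≠ 0 → P i k ≠ 0 → j = k)) ∧
      ∃ C : Matrix (Fin n) (Fin n) ℂ, C.det ≠ 0 ∧ C.BlockTriangular id ∧
        Cᵀ * A * C = P := by
  refine existsUnique_of_exists_of_unique ?_ ?_
  · have hB : ∀ x y, Matrix.toBilin' A x y = Matrix.toBilin' A y x := by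
      intro x y
      rw [Matrix.toBilin'_apply', Matrix.toBilin'_apply', Matrix.dotProduct_mulVec,
        ← Matrix.mulVec_transpose, hA.eq, dotProduct_comm]
    obtain ⟨w, hw, hw1, hw2⟩ := PatternAux.exists_aux (Matrix.toBilin' A) hB Finset.univ
      (fun k => Pi.single k 1)
      (fun k => ⟨by simp, fun l hl => by simp [hl.ne']⟩) (by simp) (by simp)
    let C : Matrix (Fin n) (Fin n) ℂ := Matrix.of fun l k => w k l
    have hC : C.BlockTriangular id := fun l k h => (hw k).2 l h
    have hP : ∀ i j, (Cᵀ * A * C) i j = Matrix.toBilin' A (w i) (w j) := by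
      intro i j
      rw [Matrix.toBilin'_apply', Matrix.mul_assoc, Matrix.mul_apply]
      rfl
    refine ⟨Cᵀ * A * C, ⟨?_, ?_, ?_⟩, C, ?_, hC, rfl⟩
    · ext i j
      rw [Matrix.transpose_apply, hP, hP, hB]
    · intro i j; rw [hP]; exact hw1 i j
    · intro i j k; rw [hP, hP]; exact hw2 i j k
    · rw [Matrix.det_of_upperTriangular hC]
      exact Finset.prod_ne_zero_iff.mpr fun k _ => (hw k).1
  · rintro P Q ⟨⟨hP, hP1, hP2⟩, C, hCd, hC, hCP⟩ ⟨⟨hQ, hQ1, hQ2⟩, E, hEd, hE, hEQ⟩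
    have uC : IsUnit C.det := isUnit_iff_ne_zero.mpr hCd
    have uE : IsUnit E.det := isUnit_iff_ne_zero.mpr hEd
    letI iC : Invertible C := Matrix.invertibleOfIsUnitDet C uC
    letI iE : Invertible E := Matrix.invertibleOfIsUnitDet E uE
    have hCi : (C⁻¹).BlockTriangular id := Matrix.blockTriangular_inv_of_blockTriangular hC
    have hEi : (E⁻¹).BlockTriangular id := Matrix.blockTriangular_inv_of_blockTriangular hE
    have dC : (C⁻¹).det ≠ 0 := (Matrix.isUnit_nonsing_inv_det C uC).ne_zero
    have dE : (E⁻¹).det ≠ 0 := (Matrix.isUnit_nonsing_inv_det E uE).ne_zero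
    refine PatternAux.unique_aux (D := C⁻¹ * E) (M := E⁻¹ * C) hP hP1 hP2 hQ1 hQ2 hQ
      (hCi.mul hE) (hEi.mul hC)
      (PatternAux.diag_ne (hCi.mul hE) (by rw [Matrix.det_mul]; exact mul_ne_zero dC hEd))
      (PatternAux.diag_ne (hEi.mul hC) (by rw [Matrix.det_mul]; exact mul_ne_zero dE hCd)) ?_
    have l : P * (C⁻¹ * E) = Cᵀ * A * E := by
      rw [← hCP, ← Matrix.mul_assoc, Matrix.mul_assoc _ C, Matrix.mul_nonsing_inv C uC,
        Matrix.mul_one]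
    have r : (E⁻¹ * C)ᵀ * Q = Cᵀ * A * E := by
      have : (E⁻¹)ᵀ * Eᵀ = 1 := by
        rw [← Matrix.transpose_mul, Matrix.mul_nonsing_inv E uE, Matrix.transpose_one]
      calc (E⁻¹ * C)ᵀ * Q = Cᵀ * ((E⁻¹)ᵀ * Eᵀ) * A * E := by
            rw [← hEQ, Matrix.transpose_mul]; simp only [Matrix.mul_assoc]
        _ = _ := by rw [this, Matrix.mul_one]
    rw [l, r]
end
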